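/- If ρ_m(X;Y) > 0, then for every ε > 0, ĝ_ε(X;Y) ≥ (H(Y)/ρ_m²(X;Y))·min{ε, ρ_m²(X;Y)}. In particular, for ε ≥ ρ_m²(X;Y) one has ĝ_ε(X;Y) = H(Y). -/

import Mathlib

open scoped BigOperators

noncomputable section

namespace RatePrivacy

variable {α β γ : Type*}

/-- `p` is a probability mass function on a finite alphabet. -/
def IsPMF [Fintype α] (p : α → ℝ) : Prop := (∀ a, 0 ≤ p a) ∧ ∑ a, p a = 1

/-- Shannon entropy (in bits) of the distribution `p`. -/
def ent [Fintype α] (p : α → ℝ) : ℝ := ∑ a, -(p a * Real.logb 2 (p a))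

/-- First marginal of a joint distribution. -/
def margA [Fintype α] [Fintype β] (p : α × β → ℝ) : α → ℝ := fun a => ∑ b, p (a, b)

/-- Second marginal of a joint distribution. -/
def margB [Fintype α] [Fintype β] (p : α × β → ℝ) : β → ℝ := fun b => ∑ a, p (a, b)

/-- Mutual information (in bits) of a joint distribution `p`:
`I(A;B) = H(A) + H(B) - H(A,B)`. -/
def mi [Fintype α] [Fintype β] (p : α × β → ℝ) : ℝ :=
  ent (margA p) + ent (margB p) - ent p

/-- `q` is a (row-stochastic) channel. -/
def IsChannel [Fintype γ] (q : β → γ → ℝ) : Prop :=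
  (∀ y z, 0 ≤ q y z) ∧ ∀ y, ∑ z, q y z = 1

/-- Joint distribution of `(X, Z)` when `Z` is obtained from `Y` through the channel `q`
(so that `X — Y — Z` is a Markov chain). -/
def jointXZ [Fintype α] [Fintype β] [Fintype γ] (p : α × β → ℝ) (q : β → γ → ℝ) :
    α × γ → ℝ := fun xz => ∑ y, p (xz.1, y) * q y xz.2

/-- Joint distribution of `(Y, Z)` when `Z` is obtained from `Y` through the channel `q`. -/
def jointYZ [Fintype α] [Fintype β] [Fintype γ] (p : α × β → ℝ) (q : β → γ → ℝ) :
    β × γ → ℝ := fun yz => margB p yz.1 * q yz.1 yz.2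

/-- Achievable rates `I(Y;Z)` over all privacy filters `Z` (on finite alphabets, wlog `Fin n`)
with `X — Y — Z` Markov and `I(X;Z) ≤ ε`. -/
def gSet [Fintype α] [Fintype β] (p : α × β → ℝ) (ε : ℝ) : Set ℝ :=
  { r | ∃ (n : ℕ) (q : β → Fin n → ℝ), IsChannel q ∧
        mi (jointXZ p q) ≤ ε ∧ r = mi (jointYZ p q) }

/-- The rate-privacy function `g_ε(X;Y)` (privacy measured by mutual information). -/
def g [Fintype α] [Fintype β] (p : α × β → ℝ) (ε : ℝ) : ℝ := sSup (gSet p ε)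

/-- Values `E[f(A) g(B)]` over all zero-mean unit-variance `f, g`, used to define
the Hirschfeld–Gebelein–Rényi maximal correlation. -/
def corrSet [Fintype α] [Fintype β] (p : α × β → ℝ) : Set ℝ :=
  { r | ∃ (f : α → ℝ) (g : β → ℝ),
      (∑ a, margA p a * f a = 0) ∧ (∑ b, margB p b * g b = 0) ∧
      (∑ a, margA p a * (f a) ^ 2 = 1) ∧ (∑ b, margB p b * (g b) ^ 2 = 1) ∧
      r = ∑ x : α × β, p x * (f x.1 * g x.2) }

/-- Maximal correlation `ρ_m(A;B)` (equal to `0` when the constraint set is empty,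
since `sSup ∅ = 0` in `ℝ`). -/
def rhoM [Fintype α] [Fintype β] (p : α × β → ℝ) : ℝ := sSup (corrSet p)

/-- Achievable rates with maximal-correlation privacy constraint `ρ_m²(X;Z) ≤ ε`. -/
def ghSet [Fintype α] [Fintype β] (p : α × β → ℝ) (ε : ℝ) : Set ℝ :=
  { r | ∃ (n : ℕ) (q : β → Fin n → ℝ), IsChannel q ∧
        (rhoM (jointXZ p q)) ^ 2 ≤ ε ∧ r = mi (jointYZ p q) }

/-- The rate-privacy function `ĝ_ε(X;Y)` (privacy measured by squared maximal correlation). -/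
def gh [Fintype α] [Fintype β] (p : α × β → ℝ) (ε : ℝ) : ℝ := sSup (ghSet p ε)

/-- The Kullback–Leibler divergence (in bits) `D(P_{X|Y}(·|y) ‖ P_X)`. -/
def Dxy [Fintype α] [Fintype β] (p : α × β → ℝ) (y : β) : ℝ :=
  ∑ x, (p (x, y) / margB p y) * Real.logb 2 ((p (x, y) / margB p y) / margA p x)

theorem neg_mul_logb_mul (a b : ℝ) :
    -(a * b * Real.logb 2 (a * b)) =
      a * -(b * Real.logb 2 b) + b * -(a * Real.logb 2 a) := by
  rcases eq_or_ne a 0 with rfl | ha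
  · simp
  rcases eq_or_ne b 0 with rfl | hb
  · simp
  rw [Real.logb_mul ha hb]
  ring

theorem neg_sum_mul_logb_sum_le {ι : Type*} [Fintype ι] (a : ι → ℝ) (ha : ∀ i, 0 ≤ a i) :
    -((∑ i, a i) * Real.logb 2 (∑ i, a i)) ≤ ∑ i, -(a i * Real.logb 2 (a i)) := by
  rw [Finset.sum_mul, ← Finset.sum_neg_distrib]
  refine Finset.sum_le_sum fun i _ => ?_
  rcases (ha i).eq_or_lt with h | h
  · simp [← h]
  · have hle : a i ≤ ∑ j, a j := Finset.single_le_sum (fun j _ => ha j) (Finset.mem_univ i)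
    have := Real.logb_le_logb_of_le one_lt_two h hle
    have := mul_le_mul_of_nonneg_left this h.le
    linarith

theorem ent_margB_le {α β : Type*} [Fintype α] [Fintype β] (p : α × β → ℝ)
    (hp : ∀ x, 0 ≤ p x) : ent (margB p) ≤ ent p := by
  unfold ent margB
  rw [Fintype.sum_prod_type_right]
  exact Finset.sum_le_sum fun b _ => neg_sum_mul_logb_sum_le _ fun a => hp (a, b)

theorem margB_nonneg {α β : Type*} [Fintype α] [Fintype β] {p : α × β → ℝ}
    (hp : IsPMF p) (b : β) : 0 ≤ margB p b :=
  Finset.sum_nonneg fun a _ => hp.1 (a, b)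

theorem sum_margB {α β : Type*} [Fintype α] [Fintype β] {p : α × β → ℝ}
    (hp : IsPMF p) : ∑ b, margB p b = 1 := by
  rw [← hp.2, Fintype.sum_prod_type_right]
  rfl

section Channel

variable {α β γ : Type*} [Fintype α] [Fintype β] [Fintype γ]

theorem margA_jointYZ (p : α × β → ℝ) {q : β → γ → ℝ} (hq : IsChannel q) :
    margA (jointYZ p q) = margB p := by
  funext y
  simp [margA, jointYZ, ← Finset.mul_sum, hq.2]

theorem margA_jointXZ (p : α × β → ℝ) {q : β → γ → ℝ} (hq : IsChannel q) :
    margA (jointXZ p q) = margA p := by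
  funext x
  simp only [margA, jointXZ]
  rw [Finset.sum_comm]
  simp [← Finset.mul_sum, hq.2]

theorem margB_jointXZ (p : α × β → ℝ) (q : β → γ → ℝ) (z : γ) :
    margB (jointXZ p q) z = ∑ y, margB p y * q y z := by
  simp only [margB, jointXZ, Finset.sum_mul]
  rw [Finset.sum_comm]

theorem sum_margB_jointXZ (p : α × β → ℝ) (q : β → γ → ℝ) (g : γ → ℝ) :
    ∑ z, margB (jointXZ p q) z * g z = ∑ y, margB p y * ∑ z, q y z * g z := by
  simp only [margB_jointXZ, Finset.sum_mul, Finset.mul_sum]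
  rw [Finset.sum_comm]
  simp only [mul_assoc]

theorem sum_jointXZ (p : α × β → ℝ) (q : β → γ → ℝ) (f : α → ℝ) (g : γ → ℝ) :
    ∑ x : α × γ, jointXZ p q x * (f x.1 * g x.2) =
      ∑ x : α × β, p x * (f x.1 * ∑ z, q x.2 z * g z) := by
  simp only [Fintype.sum_prod_type, jointXZ, Finset.sum_mul, Finset.mul_sum]
  refine Finset.sum_congr rfl fun x _ => ?_
  rw [Finset.sum_comm]
  refine Finset.sum_congr rfl fun y _ => Finset.sum_congr rfl fun z _ => ?_
  ring

theorem mi_jointYZ_le {p : α × β → ℝ} (hp : IsPMF p) {q : β → γ → ℝ} (hq : IsChannel q) :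
    mi (jointYZ p q) ≤ ent (margB p) := by
  have h := ent_margB_le (jointYZ p q) fun x => mul_nonneg (margB_nonneg hp x.1) (hq.1 _ _)
  rw [mi, margA_jointYZ p hq]
  linarith

end Channel

/-- A covariance with a normalized `f` is controlled by the maximal correlation. -/
theorem sq_sum_le_rhoM_sq {α β : Type*} [Fintype α] [Fintype β] {p : α × β → ℝ}
    (hp : IsPMF p) (hb : BddAbove (corrSet p)) {f : α → ℝ} {k : β → ℝ}
    (hf0 : ∑ a, margA p a * f a = 0) (hf1 : ∑ a, margA p a * (f a) ^ 2 = 1)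
    (hk0 : ∑ b, margB p b * k b = 0) :
    (∑ x : α × β, p x * (f x.1 * k x.2)) ^ 2 ≤
      (rhoM p) ^ 2 * ∑ b, margB p b * (k b) ^ 2 := by
  set v := ∑ b, margB p b * (k b) ^ 2 with hv
  have hterm : ∀ b, 0 ≤ margB p b * (k b) ^ 2 := fun b =>
    mul_nonneg (margB_nonneg hp b) (sq_nonneg _)
  have hv0 : 0 ≤ v := Finset.sum_nonneg fun b _ => hterm b
  rcases hv0.eq_or_lt with h | h
  · have hz : ∀ x : α × β, p x * (f x.1 * k x.2) = 0 := by
      intro x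
      have h1 : margB p x.2 * (k x.2) ^ 2 = 0 :=
        (Finset.sum_eq_zero_iff_of_nonneg fun b _ => hterm b).1 h.symm x.2 (Finset.mem_univ _)
      rcases mul_eq_zero.1 h1 with h2 | h2
      · have h3 : p (x.1, x.2) = 0 :=
          (Finset.sum_eq_zero_iff_of_nonneg fun a _ => hp.1 (a, x.2)).1 h2 x.1 (Finset.mem_univ _)
        simp [show p x = 0 from h3]
      · simp [pow_eq_zero_iff (two_ne_zero) |>.1 h2]
    simp [hz, ← h]
  · have key : ∀ s : ℝ, s ^ 2 * v = 1 →
        s * ∑ x : α × β, p x * (f x.1 * k x.2) ≤ rhoM p := by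
      intro s hs
      refine le_csSup hb ⟨f, fun b => s * k b, hf0, ?_, hf1, ?_, ?_⟩
      · rw [← mul_zero s, ← hk0, Finset.mul_sum]
        exact Finset.sum_congr rfl fun b _ => by ring
      · rw [← hs, hv, Finset.mul_sum]
        exact Finset.sum_congr rfl fun b _ => by ring
      · rw [Finset.mul_sum]
        exact Finset.sum_congr rfl fun b _ => by ring
    have hsq : (Real.sqrt v)⁻¹ ^ 2 * v = 1 := by
      rw [inv_pow, Real.sq_sqrt hv0, inv_mul_cancel₀ h.ne']
    have h1 := key _ hsq
    have h2 := key (-(Real.sqrt v)⁻¹) (by rw [neg_sq]; exact hsq)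
    have h3 := sq_le_sq' (by linarith) h1
    calc (∑ x : α × β, p x * (f x.1 * k x.2)) ^ 2
        = ((Real.sqrt v)⁻¹ * ∑ x : α × β, p x * (f x.1 * k x.2)) ^ 2 * v := by
          rw [mul_pow, mul_right_comm, hsq, one_mul]
      _ ≤ (rhoM p) ^ 2 * v := mul_le_mul_of_nonneg_right h3 hv0

/-- The erasure channel that keeps its input with probability `δ`; the symbol `0` is the
erasure. -/
def erasure {β : Type*} {m : ℕ} (e : β ≃ Fin m) (δ : ℝ) (y : β) : Fin (m + 1) → ℝ :=
  Fin.cons (1 - δ) fun i => if e y = i then δ else 0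

theorem sum_erasure_mul {β : Type*} {m : ℕ} (e : β ≃ Fin m) (δ : ℝ) (y : β)
    (g : Fin (m + 1) → ℝ) :
    ∑ z, erasure e δ y z * g z = (1 - δ) * g 0 + δ * g (e y).succ := by
  simp [erasure, Fin.sum_univ_succ]

theorem isChannel_erasure {β : Type*} {m : ℕ} (e : β ≃ Fin m) {δ : ℝ} (h0 : 0 ≤ δ) (h1 : δ ≤ 1) :
    IsChannel (erasure e δ) := by
  refine ⟨fun y z => ?_, fun y => ?_⟩
  · refine Fin.cases ?_ (fun i => ?_) z
    · simpa [erasure] using h1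
    · simp only [erasure, Fin.cons_succ]
      split_ifs <;> simp [h0]
  · simpa using sum_erasure_mul e δ y fun _ => 1

section Erasure

variable {α β : Type*} [Fintype α] [Fintype β] {m : ℕ} (e : β ≃ Fin m) (δ : ℝ)

theorem sum_mul_erasure_zero (w : β → ℝ) :
    ∑ y, w y * erasure e δ y 0 = (∑ y, w y) * (1 - δ) := by
  simp [erasure, Finset.sum_mul]

theorem sum_mul_erasure_succ (w : β → ℝ) (y : β) :
    ∑ y', w y' * erasure e δ y' (e y).succ = w y * δ := by
  classical
  simp [erasure]

variable {δ}

theorem mi_jointYZ_erasure {p : α × β → ℝ} (hp : IsPMF p) (h0 : 0 ≤ δ) (h1 : δ ≤ 1) :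
    mi (jointYZ p (erasure e δ)) = δ * ent (margB p) := by
  classical
  have hs := sum_margB hp
  have hB : ent (margB (jointYZ p (erasure e δ))) =
      -((1 - δ) * Real.logb 2 (1 - δ)) +
        ∑ y, -(margB p y * δ * Real.logb 2 (margB p y * δ)) := by
    rw [ent, Fin.sum_univ_succ, ← e.sum_comp]
    simp only [margB, jointYZ]
    have hz := sum_mul_erasure_zero e δ (margB p)
    have hsucc := sum_mul_erasure_succ e δ (margB p)
    simp only [margB] at hz hsucc hs
    simp only [hz, hsucc, hs, one_mul]
  have hJ : ent (jointYZ p (erasure e δ)) =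
      ∑ y, (-(margB p y * (1 - δ) * Real.logb 2 (margB p y * (1 - δ))) +
        -(margB p y * δ * Real.logb 2 (margB p y * δ))) := by
    rw [ent, Fintype.sum_prod_type]
    refine Finset.sum_congr rfl fun y _ => ?_
    rw [Fin.sum_univ_succ, ← e.sum_comp, Finset.sum_eq_single y]
    · simp [jointYZ, erasure]
    · intro b _ hb
      simp [jointYZ, erasure, hb.symm]
    · simp
  have hE : ∑ y, -(margB p y * (1 - δ) * Real.logb 2 (margB p y * (1 - δ))) =
      -((1 - δ) * Real.logb 2 (1 - δ)) + (1 - δ) * ent (margB p) := by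
    simp only [neg_mul_logb_mul, Finset.sum_add_distrib, ← Finset.sum_mul, ← Finset.mul_sum, hs,
      ent, one_mul]
  rw [mi, margA_jointYZ p (isChannel_erasure e h0 h1), hB, hJ, Finset.sum_add_distrib, hE]
  ring

theorem rhoM_sq_jointXZ_erasure_le {p : α × β → ℝ} (hp : IsPMF p) (hb : BddAbove (corrSet p))
    (h0 : 0 ≤ δ) (h1 : δ ≤ 1) :
    (rhoM (jointXZ p (erasure e δ))) ^ 2 ≤ δ * (rhoM p) ^ 2 := by
  have hs := sum_margB hp
  set c := δ * (rhoM p) ^ 2 with hc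
  have hc0 : 0 ≤ c := mul_nonneg h0 (sq_nonneg _)
  have key : ∀ r ∈ corrSet (jointXZ p (erasure e δ)), r ^ 2 ≤ c := by
    rintro r ⟨f, g, hf0, hg0, hf1, hg1, rfl⟩
    rw [margA_jointXZ p (isChannel_erasure e h0 h1)] at hf0 hf1
    rw [sum_margB_jointXZ p _ fun z => (g z) ^ 2] at hg1
    simp only [sum_erasure_mul] at hg1
    set h : β → ℝ := fun y => g (e y).succ with hh
    set μ := ∑ y, margB p y * h y with hμ
    have hk0 : ∑ b, margB p b * (h b - μ) = 0 := by
      simp only [mul_sub, Finset.sum_sub_distrib, ← Finset.sum_mul, hs]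
      rw [← hμ]
      ring
    have hvar : ∑ b, margB p b * (h b - μ) ^ 2 = ∑ b, margB p b * (h b) ^ 2 - μ ^ 2 := by
      have : ∀ b, margB p b * (h b - μ) ^ 2 =
          margB p b * (h b) ^ 2 - 2 * μ * (margB p b * h b) + margB p b * μ ^ 2 := fun b => by ring
      simp only [this, Finset.sum_add_distrib, Finset.sum_sub_distrib, ← Finset.sum_mul,
        ← Finset.mul_sum, hs]
      rw [← hμ]
      ring
    have hg1' : (1 - δ) * (g 0) ^ 2 + δ * ∑ b, margB p b * (h b) ^ 2 = 1 := by
      simp only [mul_add, Finset.sum_add_distrib, ← Finset.sum_mul, hs, one_mul,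
        mul_left_comm _ δ, ← Finset.mul_sum] at hg1
      exact hg1
    have hfc : ∀ t : ℝ, ∑ x : α × β, p x * (f x.1 * t) = 0 := by
      intro t
      rw [Fintype.sum_prod_type, ← zero_mul t, ← hf0, Finset.sum_mul]
      refine Finset.sum_congr rfl fun a _ => ?_
      rw [margA, Finset.sum_mul, Finset.sum_mul]
      exact Finset.sum_congr rfl fun b _ => by ring
    have hr : ∑ x : α × Fin (m + 1), jointXZ p (erasure e δ) x * (f x.1 * g x.2) =
        δ * ∑ x : α × β, p x * (f x.1 * (h x.2 - μ)) := by
      rw [sum_jointXZ, ← add_zero (δ * _), ← hfc ((1 - δ) * g 0 + δ * μ), Finset.mul_sum,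
        ← Finset.sum_add_distrib]
      refine Finset.sum_congr rfl fun x _ => ?_
      rw [sum_erasure_mul]
      simp only [hh]
      ring
    have hcs := sq_sum_le_rhoM_sq hp hb hf0 hf1 hk0
    have hle : δ * ∑ b, margB p b * (h b - μ) ^ 2 ≤ 1 := by
      rw [hvar]
      have := mul_nonneg (sub_nonneg.2 h1) (sq_nonneg (g 0))
      have := mul_nonneg h0 (sq_nonneg μ)
      linarith
    rw [hr, mul_pow]
    calc _ ≤ δ ^ 2 * ((rhoM p) ^ 2 * ∑ b, margB p b * (h b - μ) ^ 2) :=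
          mul_le_mul_of_nonneg_left hcs (sq_nonneg δ)
      _ = c * (δ * ∑ b, margB p b * (h b - μ) ^ 2) := by rw [hc]; ring
      _ ≤ c := mul_le_of_le_one_right hc0 hle
  have habs : ∀ r ∈ corrSet (jointXZ p (erasure e δ)), |r| ≤ Real.sqrt c := fun r hr =>
    Real.abs_le_sqrt (key r hr)
  have hup : rhoM (jointXZ p (erasure e δ)) ≤ Real.sqrt c :=
    Real.sSup_le (fun r hr => (abs_le.1 (habs r hr)).2) (Real.sqrt_nonneg c)
  have hlow : -Real.sqrt c ≤ rhoM (jointXZ p (erasure e δ)) := by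
    rcases (corrSet (jointXZ p (erasure e δ))).eq_empty_or_nonempty with h | ⟨r, hr⟩
    · simp [rhoM, h]
    · exact (abs_le.1 (habs r hr)).1.trans
        (le_csSup ⟨Real.sqrt c, fun r hr => (abs_le.1 (habs r hr)).2⟩ hr)
  exact (sq_le_sq' hlow hup).trans_eq (Real.sq_sqrt hc0)

end Erasure

/-- If `ρ_m(X;Y) > 0`, then for every `ε > 0`,
`ĝ_ε(X;Y) ≥ (H(Y)/ρ_m²(X;Y))·min{ε, ρ_m²(X;Y)}`; in particular, for `ε ≥ ρ_m²(X;Y)`,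
`ĝ_ε(X;Y) = H(Y)`. -/
theorem stmt4 {𝓧 𝓨 : Type*} [Fintype 𝓧] [Fintype 𝓨]
    (p : 𝓧 × 𝓨 → ℝ) (hp : IsPMF p) (hρ : 0 < rhoM p) :
    ∀ ε : ℝ, 0 < ε →
      (ent (margB p) / (rhoM p) ^ 2) * min ε ((rhoM p) ^ 2) ≤ gh p ε ∧
      ((rhoM p) ^ 2 ≤ ε → gh p ε = ent (margB p)) := by
  intro ε hε
  have hb : BddAbove (corrSet p) := by
    by_contra h
    exact hρ.ne' (Real.sSup_of_not_bddAbove h)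
  have hρ2 : 0 < (rhoM p) ^ 2 := by positivity
  set δ := min ε ((rhoM p) ^ 2) / (rhoM p) ^ 2 with hδ
  have h0 : 0 ≤ δ := by positivity
  have h1 : δ ≤ 1 := (div_le_one hρ2).2 (min_le_right _ _)
  have hδρ : δ * (rhoM p) ^ 2 = min ε ((rhoM p) ^ 2) := div_mul_cancel₀ _ hρ2.ne'
  have hub : ∀ r ∈ ghSet p ε, r ≤ ent (margB p) := by
    rintro r ⟨n, q, hq, -, rfl⟩
    exact mi_jointYZ_le hp hq
  let e := Fintype.equivFin 𝓨
  have hmem : δ * ent (margB p) ∈ ghSet p ε :=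
    ⟨_, erasure e δ, isChannel_erasure e h0 h1,
      (rhoM_sq_jointXZ_erasure_le e hp hb h0 h1).trans (hδρ.trans_le (min_le_left _ _)),
      (mi_jointYZ_erasure e hp h0 h1).symm⟩
  have hmain : (ent (margB p) / (rhoM p) ^ 2) * min ε ((rhoM p) ^ 2) ≤ gh p ε := by
    have : (ent (margB p) / (rhoM p) ^ 2) * min ε ((rhoM p) ^ 2) = δ * ent (margB p) := by
      rw [hδ]
      ring
    rw [this]
    exact le_csSup ⟨_, hub⟩ hmem
  refine ⟨hmain, fun hle => le_antisymm (csSup_le ⟨_, hmem⟩ hub) ?_⟩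
  rwa [min_eq_right hle, div_mul_cancel₀ _ hρ2.ne'] at hmain

end RatePrivacy
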